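/- Characterization of new dual EP matrices: with the Hartwig–Spindelböck decomposition data as in the context and Â^N := Û · fromBlocks(K*Σ₁⁻¹, 0, L*Σ₁⁻¹, 0) · Û* (the NDMPI of Â), the matrix Â is new dual EP (i.e., Â·Â^N = Â^N·Â) if and only if L = 0. -/

import Mathlib

open Matrix

/-- The dual complex numbers `𝔻ℂ := ℂ[ε]`, the trivial square-zero extension of `ℂ` by `ℂ`. -/
abbrev DC := TrivSqZeroExt ℂ ℂ

/-- Star on dual complex numbers: `(a + b·ε)* = conj a + conj b · ε`. -/
instance : Star DC :=
  ⟨fun x => ((starRingEnd ℂ) x.fst, (starRingEnd ℂ) x.snd)⟩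

/-- A positive appreciable real dual number: the standard part is a positive real and
the dual part is real. -/
def PosAppreciable (x : DC) : Prop :=
  (∃ a : ℝ, 0 < a ∧ x.fst = (a : ℂ)) ∧ (∃ b : ℝ, x.snd = (b : ℂ))

/-- A nonnegative infinitesimal real dual number: the standard part is `0` and
the dual part is a nonnegative real. -/
def NonnegInfinitesimal (x : DC) : Prop :=
  x.fst = 0 ∧ ∃ b : ℝ, 0 ≤ b ∧ x.snd = (b : ℂ)

/-- The standard part of a dual complex matrix. -/
def stdPart {m n : Type*} (X : Matrix m n DC) : Matrix m n ℂ :=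
  X.map TrivSqZeroExt.fst

/-- The dual part of a dual complex matrix. -/
def dualPart {m n : Type*} (X : Matrix m n DC) : Matrix m n ℂ :=
  X.map TrivSqZeroExt.snd

lemma PosAppreciable.isUnit {x : DC} (hx : PosAppreciable x) : IsUnit x := by
  obtain ⟨⟨a, ha, hxa⟩, -⟩ := hx
  rw [TrivSqZeroExt.isUnit_iff_isUnit_fst, hxa, isUnit_iff_ne_zero]
  exact_mod_cast ha.ne'

lemma DC.star_zero : star (0 : DC) = 0 :=
  TrivSqZeroExt.ext (map_zero (starRingEnd ℂ)) (map_zero (starRingEnd ℂ))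

lemma isUnit_det_diagonal_of_posAppreciable {r : ℕ} {d : Fin r → DC}
    (hd : ∀ i, PosAppreciable (d i)) : IsUnit (Matrix.diagonal d).det := by
  rw [Matrix.det_diagonal, IsUnit.prod_univ_iff]
  exact fun i => (hd i).isUnit

/-- Conjugation by an invertible matrix is multiplicative. -/
lemma conj_mul_conj {n R : Type*} [Fintype n] [DecidableEq n] [Ring R]
    {U V : Matrix n n R} (hVU : V * U = 1) (F G : Matrix n n R) :
    U * F * V * (U * G * V) = U * (F * G) * V := by
  calc U * F * V * (U * G * V) = U * F * (V * U) * G * V := by simp only [Matrix.mul_assoc]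
    _ = U * (F * G) * V := by rw [hVU, Matrix.mul_one, Matrix.mul_assoc U]

lemma conj_inj {n R : Type*} [Fintype n] [DecidableEq n] [Ring R]
    {U V : Matrix n n R} (hVU : V * U = 1) {F G : Matrix n n R} :
    U * F * V = U * G * V ↔ F = G := by
  refine ⟨fun h => ?_, fun h => h ▸ rfl⟩
  have key : ∀ X : Matrix n n R, V * (U * X * V) * U = X := fun X => by
    calc V * (U * X * V) * U = V * U * X * (V * U) := by simp only [Matrix.mul_assoc]
      _ = X := by rw [hVU, Matrix.one_mul, Matrix.mul_one]
  rw [← key F, h, key G]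

/-- Characterization of new dual EP matrices. -/
theorem new_dual_EP_iff
    {r s : ℕ}
    -- `Û`, a unitary matrix
    (U : Matrix (Fin r ⊕ Fin s) (Fin r ⊕ Fin s) DC)
    (hU₁ : U * Uᴴ = 1) (hU₂ : Uᴴ * U = 1)
    -- the blocks `K, L, M, N` forming a unitary block matrix
    (K : Matrix (Fin r) (Fin r) DC) (L : Matrix (Fin r) (Fin s) DC)
    (M : Matrix (Fin s) (Fin r) DC) (N : Matrix (Fin s) (Fin s) DC)
    (hW₁ : fromBlocks K L M N * (fromBlocks K L M N)ᴴ = 1)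
    (hW₂ : (fromBlocks K L M N)ᴴ * fromBlocks K L M N = 1)
    -- `Σ₁` diagonal with positive appreciable real dual diagonal entries
    (S₁ : Matrix (Fin r) (Fin r) DC) (d₁ : Fin r → DC)
    (hS₁ : S₁ = Matrix.diagonal d₁) (hd₁ : ∀ i, PosAppreciable (d₁ i))
    -- `Σ₂` diagonal with nonnegative infinitesimal real dual diagonal entries
    (S₂ : Matrix (Fin s) (Fin s) DC) (d₂ : Fin s → DC)
    (hS₂ : S₂ = Matrix.diagonal d₂) (hd₂ : ∀ i, NonnegInfinitesimal (d₂ i))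
    -- the Hartwig–Spindelböck decomposition of `Â`
    (A : Matrix (Fin r ⊕ Fin s) (Fin r ⊕ Fin s) DC)
    (hA : A = U * fromBlocks (S₁ * K) (S₁ * L) (S₂ * M) (S₂ * N) * Uᴴ)
    -- `Â^N`, the NDMPI of `Â`
    (AN : Matrix (Fin r ⊕ Fin s) (Fin r ⊕ Fin s) DC)
    (hAN : AN = U * fromBlocks (Kᴴ * S₁⁻¹) 0 (Lᴴ * S₁⁻¹) 0 * Uᴴ) :
    A * AN = AN * A ↔ L = 0 := by
  have hS : IsUnit S₁.det := hS₁ ▸ isUnit_det_diagonal_of_posAppreciable hd₁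
  rw [fromBlocks_conjTranspose, fromBlocks_multiply, ← fromBlocks_one, fromBlocks_inj] at hW₁
  obtain ⟨hKL, -, hMN, -⟩ := hW₁
  have hFG : fromBlocks (S₁ * K) (S₁ * L) (S₂ * M) (S₂ * N) *
      fromBlocks (Kᴴ * S₁⁻¹) 0 (Lᴴ * S₁⁻¹) 0 =
        (fromBlocks 1 0 0 0 : Matrix (Fin r ⊕ Fin s) (Fin r ⊕ Fin s) DC) := by
    have h₁ : S₁ * K * (Kᴴ * S₁⁻¹) + S₁ * L * (Lᴴ * S₁⁻¹) = 1 := by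
      calc _ = S₁ * (K * Kᴴ + L * Lᴴ) * S₁⁻¹ := by
            simp only [Matrix.mul_assoc, Matrix.mul_add, Matrix.add_mul]
        _ = 1 := by rw [hKL, Matrix.mul_one, Matrix.mul_nonsing_inv _ hS]
    have h₂ : S₂ * M * (Kᴴ * S₁⁻¹) + S₂ * N * (Lᴴ * S₁⁻¹) = 0 := by
      calc _ = S₂ * (M * Kᴴ + N * Lᴴ) * S₁⁻¹ := by
            simp only [Matrix.mul_assoc, Matrix.mul_add, Matrix.add_mul]
        _ = 0 := by rw [hMN, Matrix.mul_zero, Matrix.zero_mul]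
    rw [fromBlocks_multiply, h₁, h₂]
    simp only [Matrix.mul_zero, add_zero]
  have hcancel : ∀ {m n : ℕ} (X : Matrix (Fin m) (Fin r) DC) (Y : Matrix (Fin r) (Fin n) DC),
      X * S₁⁻¹ * (S₁ * Y) = X * Y := fun X Y => by
    rw [Matrix.mul_assoc, Matrix.nonsing_inv_mul_cancel_left _ _ hS]
  have hGF : fromBlocks (Kᴴ * S₁⁻¹) 0 (Lᴴ * S₁⁻¹) 0 *
      fromBlocks (S₁ * K) (S₁ * L) (S₂ * M) (S₂ * N) =
        fromBlocks (Kᴴ * K) (Kᴴ * L) (Lᴴ * K) (Lᴴ * L) := by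
    simp only [fromBlocks_multiply, hcancel, Matrix.zero_mul, add_zero]
  rw [hA, hAN, conj_mul_conj hU₂, conj_mul_conj hU₂, conj_inj hU₂, hFG, hGF, fromBlocks_inj]
  constructor
  · rintro ⟨hKK, hKL', -, -⟩
    rw [← Matrix.one_mul L, ← mul_eq_one_comm.mp hKK.symm, Matrix.mul_assoc, ← hKL',
      Matrix.mul_zero]
  · rintro rfl
    have h0 : (0 : Matrix (Fin r) (Fin s) DC)ᴴ = 0 := by
      ext1 i j
      exact DC.star_zero
    rw [Matrix.zero_mul, add_zero] at hKL
    rw [mul_eq_one_comm.mp hKL, h0]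
    simp only [Matrix.mul_zero, Matrix.zero_mul, and_self]
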